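/- Claim B.1 (expectation bound for a Gaussian product restricted to an annulus). Let n ≥ 1, let x*, z ∈ ℝⁿ be deterministic vectors, let α ≥ 0 be a deterministic scalar, and let ε ∈ (0,1). Let a be a standard Gaussian random vector in ℝⁿ and set y := ⟨a, x*⟩. Then E[ |y·⟨a, z⟩| · 1{(1 − ε)α ≤ y² ≤ (1 + ε)α} ] ≤ 3·ε·‖z‖·√α. -/

import Mathlib

open MeasureTheory ProbabilityTheory Matrix
open scoped ENNReal

noncomputable section

/-- Euclidean norm of a finitely-indexed real vector. -/
def vnorm {ι : Type*} [Fintype ι] (v : ι → ℝ) : ℝ := Real.sqrt (∑ i, v i ^ 2)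

/-- Frobenius norm of a real matrix. -/
def frob {ι ι' : Type*} [Fintype ι] [Fintype ι'] (M : Matrix ι ι' ℝ) : ℝ :=
  Real.sqrt (∑ i, ∑ j, M i j ^ 2)

/-- Spectral (ℓ2 operator) norm of a real matrix. -/
def spec {ι ι' : Type*} [Fintype ι] [Fintype ι'] (M : Matrix ι ι' ℝ) : ℝ :=
  sSup {c | ∃ z, vnorm z = 1 ∧ c = vnorm (M.mulVec z)}

/-- Smallest singular value of an r×q matrix with r ≤ q (or of a square matrix):
the minimum of ‖Bᵀw‖ over unit vectors w. -/
def sigMin {ι ι' : Type*} [Fintype ι] [Fintype ι'] (B : Matrix ι ι' ℝ) : ℝ :=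
  sInf {c | ∃ w, vnorm w = 1 ∧ c = vnorm (Bᵀ.mulVec w)}

/-- The k-th column of a matrix. -/
def matCol {ι ι' : Type*} (B : Matrix ι ι' ℝ) (k : ι') : ι → ℝ := fun i => B i k

/-- Subspace distance SD(U₁,U₂) := ‖(I − U₁U₁ᵀ)U₂‖_F. -/
def SD {n r : ℕ} (U₁ U₂ : Matrix (Fin n) (Fin r) ℝ) : ℝ :=
  frob ((1 - U₁ * U₁ᵀ) * U₂)

/-- The standard Gaussian measure on ℝ. -/
def stdGaussian : Measure ℝ := gaussianReal 0 1

instance : IsProbabilityMeasure stdGaussian :=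
  inferInstanceAs (IsProbabilityMeasure (gaussianReal 0 1))

/-- A standard Gaussian random vector in ℝⁿ (i.i.d. N(0,1) coordinates). -/
def gaussianVec (n : ℕ) : Measure (Fin n → ℝ) := Measure.pi fun _ => stdGaussian

instance (n : ℕ) : IsProbabilityMeasure (gaussianVec n) := by
  unfold gaussianVec; infer_instance

/-- i.i.d. standard Gaussian random vectors a_{k i} ∈ ℝⁿ, k ∈ [q], i ∈ [m]. -/
def gaussianMatrices (q m n : ℕ) : Measure (Fin q → Fin m → Fin n → ℝ) :=
  Measure.pi fun _ => Measure.pi fun _ => gaussianVec n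

instance (q m n : ℕ) : IsProbabilityMeasure (gaussianMatrices q m n) := by
  unfold gaussianMatrices; infer_instance

/-- Truncated spectral-initialization matrix X̂₀ = (1/m) Σ_{k,i} a_ki y_ki 1{y_ki² ≤ α} e_kᵀ. -/
def initMat {n q m : ℕ} (xstar : Fin q → Fin n → ℝ) (α : ℝ)
    (ω : Fin q → Fin m → Fin n → ℝ) : Matrix (Fin n) (Fin q) ℝ :=
  Matrix.of fun j k => (1 / (m : ℝ)) * ∑ i, ω k i j * (ω k i ⬝ᵥ xstar k) *
    (if (ω k i ⬝ᵥ xstar k) ^ 2 ≤ α then 1 else 0)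

/-- Data-dependent truncation threshold α := C̃ Σ_{k,i} y_ki² / (mq). -/
def initAlpha {n q m : ℕ} (xstar : Fin q → Fin n → ℝ) (Ctil : ℝ)
    (ω : Fin q → Fin m → Fin n → ℝ) : ℝ :=
  Ctil * ((∑ k, ∑ i, (ω k i ⬝ᵥ xstar k) ^ 2) / ((m : ℝ) * q))

/-- β(α) := E[ζ² 1{‖x‖² ζ² ≤ α}] for ζ standard Gaussian. -/
def betaK (normx α : ℝ) : ℝ :=
  ∫ z, z ^ 2 * (if normx ^ 2 * z ^ 2 ≤ α then 1 else 0) ∂stdGaussian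

/-- The least-squares estimate b̂ := (UᵀAᵀAU)⁻¹ Uᵀ Aᵀ A x. -/
def lsEst {n r m : ℕ} (U : Matrix (Fin n) (Fin r) ℝ) (A : Matrix (Fin m) (Fin n) ℝ)
    (x : Fin n → ℝ) : Fin r → ℝ :=
  ((Uᵀ * Aᵀ * A * U)⁻¹ * Uᵀ * Aᵀ * A).mulVec x

/-- Gradient w.r.t. U of the squared loss: Σ_k Aᵀ(AUb̂_k − Ax*_k)b̂_kᵀ. -/
def gradU {n r q m : ℕ} (U : Matrix (Fin n) (Fin r) ℝ)
    (A : Fin q → Matrix (Fin m) (Fin n) ℝ) (xstar : Fin q → Fin n → ℝ)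
    (bhat : Fin q → Fin r → ℝ) : Matrix (Fin n) (Fin r) ℝ :=
  ∑ k, (A k)ᵀ * vecMulVec ((A k).mulVec (U.mulVec (bhat k) - xstar k)) (bhat k)

/-- `U` has orthonormal columns whose span is the span of eigenvectors of `S`
corresponding to its `r` largest eigenvalues: `S` maps the column span of `U` into itself,
and wᵀSw ≥ zᵀSz for unit w in the span and unit z orthogonal to it. -/
def IsTopREigenBasis {n r : ℕ} (S : Matrix (Fin n) (Fin n) ℝ)
    (U : Matrix (Fin n) (Fin r) ℝ) : Prop :=
  Uᵀ * U = 1 ∧ (∃ M : Matrix (Fin r) (Fin r) ℝ, S * U = U * M) ∧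
  ∀ w z : Fin n → ℝ, (∃ cvec : Fin r → ℝ, w = U.mulVec cvec) → Uᵀ.mulVec z = 0 →
    vnorm w = 1 → vnorm z = 1 → z ⬝ᵥ S.mulVec z ≤ w ⬝ᵥ S.mulVec w

/-- Sample sizes for the 2T+1 sample splits: batch τ ∈ {0,…,T} has m τ rows,
batch τ = T + t (t ∈ {1,…,T}) has m t rows. -/
def msize (m : ℕ → ℕ) (T τ : ℕ) : ℕ := if τ ≤ T then m τ else m (τ - T)

/-- The joint distribution of all 2T+1 independent sample batches of i.i.d. standard
Gaussian measurement vectors. -/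
def splitGauss (m : ℕ → ℕ) (T q n : ℕ) :
    Measure (∀ τ : Fin (2 * T + 1), Fin q → Fin (msize m T τ.1) → Fin n → ℝ) :=
  Measure.pi fun τ => gaussianMatrices q (msize m T τ.1) n

instance (m : ℕ → ℕ) (T q n : ℕ) : IsProbabilityMeasure (splitGauss m T q n) := by
  unfold splitGauss; infer_instance

end
/-- The linear functional `a ↦ ⟨a, u⟩`, as a continuous linear map. -/
def dotCLM {n : ℕ} (u : Fin n → ℝ) : (Fin n → ℝ) →L[ℝ] ℝ :=
  ∑ i, u i • ContinuousLinearMap.proj i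

lemma dotCLM_apply {n : ℕ} (u a : Fin n → ℝ) : dotCLM u a = a ⬝ᵥ u := by
  simp [dotCLM, dotProduct, mul_comm]

lemma iIndepFun_eval_gaussianVec (n : ℕ) :
    iIndepFun (fun (i : Fin n) (a : Fin n → ℝ) => a i) (gaussianVec n) :=
  iIndepFun_pi (X := fun _ x => x) fun _ => aemeasurable_id

lemma hasGaussianLaw_id_gaussianVec (n : ℕ) :
    HasGaussianLaw (fun a : Fin n → ℝ => a) (gaussianVec n) := by
  refine (iIndepFun_eval_gaussianVec n).hasGaussianLaw fun i => HasLaw.hasGaussianLaw (μ := gaussianReal 0 1) ?_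
  exact ⟨(measurable_pi_apply i).aemeasurable,
    (measurePreserving_eval (fun _ : Fin n => _root_.stdGaussian) i).map_eq⟩

lemma hasGaussianLaw_dotProduct_prod {n : ℕ} (u w : Fin n → ℝ) :
    HasGaussianLaw (fun a => (a ⬝ᵥ u, a ⬝ᵥ w)) (gaussianVec n) := by
  simpa [dotCLM_apply] using
    (hasGaussianLaw_id_gaussianVec n).map_fun ((dotCLM u).prod (dotCLM w))

lemma hasGaussianLaw_dotProduct {n : ℕ} (u : Fin n → ℝ) :
    HasGaussianLaw (fun a => a ⬝ᵥ u) (gaussianVec n) :=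
  (hasGaussianLaw_dotProduct_prod u u).fst

lemma memLp_eval_gaussianVec {n : ℕ} (i : Fin n) :
    MemLp (fun a : Fin n → ℝ => a i) 2 (gaussianVec n) := by
  simpa [dotProduct_single] using (hasGaussianLaw_dotProduct (Pi.single i (1 : ℝ))).memLp_two

lemma integral_eval_gaussianVec {n : ℕ} (i : Fin n) :
    ∫ a, a i ∂(gaussianVec n) = 0 := by
  have h := (measurePreserving_eval (fun _ : Fin n => _root_.stdGaussian) i).map_eq
  have h2 : ∫ x, x ∂(_root_.stdGaussian) = 0 := integral_id_gaussianReal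
  rw [← h, integral_map (measurable_pi_apply i).aemeasurable (by fun_prop)] at h2
  exact h2

lemma covariance_eval_gaussianVec {n : ℕ} (i j : Fin n) :
    cov[fun a => a i, fun a => a j; gaussianVec n] = if i = j then 1 else 0 := by
  split_ifs with hij
  · subst hij
    rw [covariance_self (memLp_eval_gaussianVec i).aestronglyMeasurable.aemeasurable]
    have h2 : Var[fun x => x; _root_.stdGaussian] = 1 :=
      variance_fun_id_gaussianReal.trans NNReal.coe_one
    rw [← h2]
    exact (measurePreserving_eval (fun _ : Fin n => _root_.stdGaussian) i).variance_fun_comp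
      aemeasurable_id'
  · exact ((iIndepFun_eval_gaussianVec n).indepFun hij).covariance_eq_zero
      (memLp_eval_gaussianVec i) (memLp_eval_gaussianVec j)

lemma integral_dotProduct_gaussianVec {n : ℕ} (u : Fin n → ℝ) :
    ∫ a, a ⬝ᵥ u ∂(gaussianVec n) = 0 := by
  simp only [dotProduct]
  rw [integral_finsetSum _ fun i _ =>
    ((memLp_eval_gaussianVec i).integrable (by norm_num)).mul_const _]
  simp [integral_mul_const, integral_eval_gaussianVec]

lemma covariance_dotProduct_gaussianVec {n : ℕ} (u w : Fin n → ℝ) :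
    cov[fun a => a ⬝ᵥ u, fun a => a ⬝ᵥ w; gaussianVec n] = u ⬝ᵥ w := by
  simp only [dotProduct]
  rw [covariance_fun_sum_fun_sum (fun i => (memLp_eval_gaussianVec i).mul_const _)
    (fun i => (memLp_eval_gaussianVec i).mul_const _)]
  simp [covariance_mul_const_left, covariance_mul_const_right, covariance_eval_gaussianVec]

lemma variance_dotProduct_gaussianVec {n : ℕ} (u : Fin n → ℝ) :
    Var[fun a => a ⬝ᵥ u; gaussianVec n] = u ⬝ᵥ u := by
  rw [← covariance_self (hasGaussianLaw_dotProduct u).aemeasurable,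
    covariance_dotProduct_gaussianVec]

lemma indepFun_dotProduct_gaussianVec {n : ℕ} {u w : Fin n → ℝ} (h : u ⬝ᵥ w = 0) :
    IndepFun (fun a => a ⬝ᵥ u) (fun a => a ⬝ᵥ w) (gaussianVec n) :=
  (hasGaussianLaw_dotProduct_prod u w).indepFun_of_covariance_eq_zero
    (by rw [covariance_dotProduct_gaussianVec, h])

lemma map_dotProduct_gaussianVec {n : ℕ} (u : Fin n → ℝ) :
    (gaussianVec n).map (fun a => a ⬝ᵥ u) = gaussianReal 0 (u ⬝ᵥ u).toNNReal := by
  rw [(hasGaussianLaw_dotProduct u).map_eq_gaussianReal, integral_dotProduct_gaussianVec,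
    variance_dotProduct_gaussianVec]

lemma dotProduct_self_nonneg {n : ℕ} (u : Fin n → ℝ) : 0 ≤ u ⬝ᵥ u :=
  Finset.sum_nonneg fun i _ => mul_self_nonneg (u i)

lemma vnorm_eq_sqrt_dotProduct {n : ℕ} (u : Fin n → ℝ) : vnorm u = √(u ⬝ᵥ u) := by
  simp [vnorm, dotProduct, sq]

lemma integral_abs_dotProduct_gaussianVec_le {n : ℕ} (u : Fin n → ℝ) :
    ∫ a, |a ⬝ᵥ u| ∂(gaussianVec n) ≤ vnorm u := by
  have hL := (hasGaussianLaw_dotProduct u).memLp_two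
  have h1 := variance_nonneg (fun a => |a ⬝ᵥ u|) (gaussianVec n)
  have h2 := variance_dotProduct_gaussianVec u
  rw [variance_eq_sub (X := fun a => |a ⬝ᵥ u|) hL.abs] at h1
  rw [variance_eq_sub hL, integral_dotProduct_gaussianVec] at h2
  simp only [Pi.pow_apply, sq_abs] at h1 h2
  rw [vnorm_eq_sqrt_dotProduct]
  apply Real.le_sqrt_of_sq_le
  linarith

lemma abs_mul_exp_neg_sq_half_le (x : ℝ) : |x| * Real.exp (-x ^ 2 / 2) ≤ 1 := by
  rw [neg_div, Real.exp_neg, ← div_eq_mul_inv, div_le_one (Real.exp_pos _)]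
  nlinarith [Real.add_one_le_exp (x ^ 2 / 2), sq_abs x, sq_nonneg (|x| - 1)]

lemma sq_mul_exp_neg_sq_half_le (x : ℝ) : x ^ 2 * Real.exp (-x ^ 2 / 2) ≤ 1 := by
  rw [neg_div, Real.exp_neg, ← div_eq_mul_inv, div_le_one (Real.exp_pos _)]
  have h : Real.exp (x ^ 2 / 2) = Real.exp (x ^ 2 / 4) ^ 2 := by
    rw [← Real.exp_nat_mul]; congr 1; push_cast; ring
  rw [h]
  nlinarith [Real.add_one_le_exp (x ^ 2 / 4), sq_nonneg x, sq_nonneg (x ^ 2 / 4 - 1)]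

lemma gaussianPDFReal_zero_sq {s : ℝ} (hs : 0 < s) (x : ℝ) :
    gaussianPDFReal 0 (s ^ 2).toNNReal x
      = (√(2 * Real.pi))⁻¹ * s⁻¹ * Real.exp (-(x / s) ^ 2 / 2) := by
  rw [gaussianPDFReal_def]
  simp only [Real.coe_toNNReal _ (sq_nonneg s), sub_zero]
  rw [Real.sqrt_mul (by positivity), Real.sqrt_sq hs.le, mul_inv]
  congr 2
  field_simp

lemma inv_sqrt_two_pi_le : (√(2 * Real.pi))⁻¹ ≤ 2 / 5 := by
  rw [inv_le_comm₀ (by positivity) (by norm_num)]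
  apply Real.le_sqrt_of_sq_le
  nlinarith [Real.pi_gt_d2]

lemma gaussianPDFReal_mul_abs_le {s : ℝ} (hs : 0 < s) (x : ℝ) :
    gaussianPDFReal 0 (s ^ 2).toNNReal x * |x| ≤ 2 / 5 := by
  rw [gaussianPDFReal_zero_sq hs]
  calc (√(2 * Real.pi))⁻¹ * s⁻¹ * Real.exp (-(x / s) ^ 2 / 2) * |x|
      = (√(2 * Real.pi))⁻¹ * (|x / s| * Real.exp (-(x / s) ^ 2 / 2)) := by
        rw [abs_div, abs_of_pos hs]; ring
    _ ≤ 2 / 5 * 1 := mul_le_mul inv_sqrt_two_pi_le (abs_mul_exp_neg_sq_half_le _)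
        (by positivity) (by norm_num)
    _ = 2 / 5 := by norm_num

lemma gaussianPDFReal_mul_sq_le {s : ℝ} (hs : 0 < s) (x : ℝ) :
    gaussianPDFReal 0 (s ^ 2).toNNReal x * x ^ 2 ≤ 2 / 5 * s := by
  rw [gaussianPDFReal_zero_sq hs]
  calc (√(2 * Real.pi))⁻¹ * s⁻¹ * Real.exp (-(x / s) ^ 2 / 2) * x ^ 2
      = (√(2 * Real.pi))⁻¹ * ((x / s) ^ 2 * Real.exp (-(x / s) ^ 2 / 2)) * s := by
        field_simp
    _ ≤ 2 / 5 * 1 * s := by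
        gcongr
        · exact inv_sqrt_two_pi_le
        · exact sq_mul_exp_neg_sq_half_le _
    _ = 2 / 5 * s := by norm_num

/-- The set of reals whose square is within relative error `ε` of `α`. -/
def sqAnnulus (ε α : ℝ) : Set ℝ := {x | (1 - ε) * α ≤ x ^ 2 ∧ x ^ 2 ≤ (1 + ε) * α}

lemma measurableSet_sqAnnulus (ε α : ℝ) : MeasurableSet (sqAnnulus ε α) :=
  (measurableSet_le (f := fun _ : ℝ => (1 - ε) * α) (g := fun x => x ^ 2)
    (by fun_prop) (by fun_prop)).inter
    (measurableSet_le (f := fun x : ℝ => x ^ 2) (g := fun _ => (1 + ε) * α)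
      (by fun_prop) (by fun_prop))

lemma sqrt_one_add_sub_sqrt_one_sub_le {ε : ℝ} (hε0 : 0 < ε) (hε1 : ε < 1) :
    √(1 + ε) - √(1 - ε) ≤ 3 / 2 * ε := by
  have h1 : 1 + ε / 3 ≤ √(1 + ε) := Real.le_sqrt_of_sq_le (by nlinarith)
  have h2 : 1 - ε ≤ √(1 - ε) := Real.le_sqrt_of_sq_le (by nlinarith)
  have h3 := Real.sq_sqrt (show (0 : ℝ) ≤ 1 + ε by linarith)
  have h4 := Real.sq_sqrt (show (0 : ℝ) ≤ 1 - ε by linarith)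
  have h5 : (√(1 + ε) - √(1 - ε)) * (√(1 + ε) + √(1 - ε)) = 2 * ε := by nlinarith
  by_contra! h
  nlinarith

lemma volume_sqAnnulus_le {ε : ℝ} (α : ℝ) (hε0 : 0 < ε) (hε1 : ε < 1) :
    volume (sqAnnulus ε α) ≤ ENNReal.ofReal (3 * ε * √α) := by
  set a := √(1 - ε) * √α
  set b := √(1 + ε) * √α
  have hsub : sqAnnulus ε α ⊆ Set.Icc a b ∪ Set.Icc (-b) (-a) := by
    rintro x ⟨hl, hu⟩
    have ha : a ≤ |x| := by
      simp only [a]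
      rw [← Real.sqrt_mul (by linarith), ← Real.sqrt_sq_eq_abs]
      exact Real.sqrt_le_sqrt hl
    have hb : |x| ≤ b := by
      simp only [b]
      rw [← Real.sqrt_mul (by linarith), ← Real.sqrt_sq_eq_abs]
      exact Real.sqrt_le_sqrt hu
    rcases abs_cases x with ⟨h, _⟩ | ⟨h, _⟩
    · left; constructor <;> linarith
    · right; constructor <;> linarith
  have hab : b - a ≤ 3 / 2 * ε * √α := by
    have := mul_le_mul_of_nonneg_right (sqrt_one_add_sub_sqrt_one_sub_le hε0 hε1)
      (Real.sqrt_nonneg α)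
    simp only [a, b]
    linarith
  calc volume (sqAnnulus ε α) ≤ volume (Set.Icc a b) + volume (Set.Icc (-b) (-a)) :=
        (measure_mono hsub).trans (measure_union_le _ _)
    _ ≤ ENNReal.ofReal (3 / 2 * ε * √α) + ENNReal.ofReal (3 / 2 * ε * √α) := by
        rw [Real.volume_Icc, Real.volume_Icc]
        exact add_le_add (ENNReal.ofReal_le_ofReal hab) (ENNReal.ofReal_le_ofReal (by linarith))
    _ = ENNReal.ofReal (3 * ε * √α) := by
        rw [← ENNReal.ofReal_add (by positivity) (by positivity)]
        congr 1; ring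

lemma integral_indicator_sqAnnulus_gaussianReal_le {v : NNReal} (hv : v ≠ 0) {g : ℝ → ℝ}
    (hg : ∀ x, 0 ≤ g x) {M : ℝ} (hM : ∀ x, gaussianPDFReal 0 v x * g x ≤ M)
    {ε : ℝ} (α : ℝ) (hε0 : 0 < ε) (hε1 : ε < 1) :
    ∫ x, (sqAnnulus ε α).indicator g x ∂(gaussianReal 0 v) ≤ M * (3 * ε * √α) := by
  have hM0 : 0 ≤ M := (mul_nonneg (gaussianPDFReal_nonneg 0 v 0) (hg 0)).trans (hM 0)
  have hS := measurableSet_sqAnnulus ε α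
  have hvol := volume_sqAnnulus_le α hε0 hε1
  rw [integral_gaussianReal_eq_integral_smul hv]
  calc ∫ x, gaussianPDFReal 0 v x • (sqAnnulus ε α).indicator g x
      ≤ ∫ x, (sqAnnulus ε α).indicator (fun _ => M) x := by
        refine integral_mono_of_nonneg (ae_of_all _ fun x => ?_) ?_ (ae_of_all _ fun x => ?_)
        · exact mul_nonneg (gaussianPDFReal_nonneg _ _ _)
            (Set.indicator_nonneg (fun x _ => hg x) x)
        · exact (integrable_indicator_iff hS).2
            (integrableOn_const (hvol.trans_lt ENNReal.ofReal_lt_top).ne)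
        · by_cases hx : x ∈ sqAnnulus ε α
          · simpa [hx] using hM x
          · simp [hx]
    _ = M * volume.real (sqAnnulus ε α) := by
        rw [integral_indicator hS, setIntegral_const, smul_eq_mul, mul_comm]
    _ ≤ M * (3 * ε * √α) :=
        mul_le_mul_of_nonneg_left (ENNReal.toReal_le_of_le_ofReal (by positivity) hvol) hM0

lemma integral_indicator_sqAnnulus_dotProduct_le {n : ℕ} {u : Fin n → ℝ} (hu : 0 < vnorm u)
    {g : ℝ → ℝ} (hgm : Measurable g) (hg : ∀ x, 0 ≤ g x) {M : ℝ}
    (hM : ∀ x, gaussianPDFReal 0 (vnorm u ^ 2).toNNReal x * g x ≤ M)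
    {ε : ℝ} (α : ℝ) (hε0 : 0 < ε) (hε1 : ε < 1) :
    ∫ a, (sqAnnulus ε α).indicator g (a ⬝ᵥ u) ∂(gaussianVec n) ≤ M * (3 * ε * √α) := by
  have hsq : vnorm u ^ 2 = u ⬝ᵥ u := by
    rw [vnorm_eq_sqrt_dotProduct, Real.sq_sqrt (dotProduct_self_nonneg u)]
  have hv : (vnorm u ^ 2).toNNReal ≠ 0 := by
    rw [Ne, Real.toNNReal_eq_zero, not_le]; positivity
  have h := integral_indicator_sqAnnulus_gaussianReal_le hv hg hM α hε0 hε1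
  rw [hsq, ← map_dotProduct_gaussianVec, integral_map
    (hasGaussianLaw_dotProduct u).aemeasurable
    (hgm.indicator (measurableSet_sqAnnulus ε α)).aestronglyMeasurable] at h
  exact h

/-- Orthogonal decomposition of `z` along a nonzero vector `u`. -/
lemma exists_eq_smul_add_orthogonal {n : ℕ} {u : Fin n → ℝ} (hu : 0 < vnorm u)
    (z : Fin n → ℝ) :
    ∃ (c : ℝ) (w : Fin n → ℝ), z = c • u + w ∧ u ⬝ᵥ w = 0 ∧ |c| * vnorm u ≤ vnorm z ∧
      vnorm w ≤ vnorm z := by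
  have hsq : vnorm u ^ 2 = u ⬝ᵥ u := by
    rw [vnorm_eq_sqrt_dotProduct, Real.sq_sqrt (dotProduct_self_nonneg u)]
  have huu : u ⬝ᵥ u ≠ 0 := by rw [← hsq]; positivity
  obtain ⟨c, hc⟩ : ∃ c, c = (u ⬝ᵥ z) / (u ⬝ᵥ u) := ⟨_, rfl⟩
  obtain ⟨w, hw⟩ : ∃ w, w = z - c • u := ⟨_, rfl⟩
  have hz : z = c • u + w := by rw [hw]; abel
  have horth : u ⬝ᵥ w = 0 := by
    rw [hw, dotProduct_sub, dotProduct_smul, smul_eq_mul, hc]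
    field_simp
    ring
  have hpyth : z ⬝ᵥ z = c ^ 2 * (u ⬝ᵥ u) + w ⬝ᵥ w := by
    have horth' : w ⬝ᵥ u = 0 := by rw [dotProduct_comm, horth]
    rw [hz]
    simp only [add_dotProduct, dotProduct_add, smul_dotProduct, dotProduct_smul, horth, horth',
      smul_eq_mul]
    ring
  refine ⟨c, w, hz, horth, ?_, ?_⟩
  · rw [vnorm_eq_sqrt_dotProduct z]
    apply Real.le_sqrt_of_sq_le
    rw [mul_pow, sq_abs, hsq, hpyth]
    linarith [dotProduct_self_nonneg w]
  · rw [vnorm_eq_sqrt_dotProduct w, vnorm_eq_sqrt_dotProduct z]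
    apply Real.sqrt_le_sqrt
    rw [hpyth]
    nlinarith [mul_nonneg (sq_nonneg c) (dotProduct_self_nonneg u)]

/-- **Claim B.1** (expectation bound for a Gaussian product restricted to an annulus). -/
theorem claimB1 (n : ℕ) (hn : 1 ≤ n) (xstar z : Fin n → ℝ) (α : ℝ) (hα : 0 ≤ α)
    (ε : ℝ) (hε0 : 0 < ε) (hε1 : ε < 1) :
    (∫ a, |(a ⬝ᵥ xstar) * (a ⬝ᵥ z)| *
        (if (1 - ε) * α ≤ (a ⬝ᵥ xstar) ^ 2 ∧ (a ⬝ᵥ xstar) ^ 2 ≤ (1 + ε) * α then 1 else 0)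
        ∂(gaussianVec n)) ≤ 3 * ε * vnorm z * Real.sqrt α := by
  have hz0 : 0 ≤ vnorm z := Real.sqrt_nonneg _
  rcases (show 0 ≤ vnorm xstar from Real.sqrt_nonneg _).eq_or_lt with hx | hx
  · have hx0 : xstar = 0 := by
      rw [vnorm_eq_sqrt_dotProduct, eq_comm, Real.sqrt_eq_zero (dotProduct_self_nonneg _)] at hx
      exact dotProduct_self_eq_zero.1 hx
    simp only [hx0, dotProduct_zero, zero_mul, abs_zero, integral_zero]
    positivity
  obtain ⟨c, w, hz, horth, hc, hw⟩ := exists_eq_smul_add_orthogonal hx z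
  have hS := measurableSet_sqAnnulus ε α
  have hSabs : Measurable ((sqAnnulus ε α).indicator fun x : ℝ => |x|) :=
    (by fun_prop : Measurable fun x : ℝ => |x|).indicator hS
  have hSsq : Measurable ((sqAnnulus ε α).indicator fun x : ℝ => x ^ 2) :=
    (by fun_prop : Measurable fun x : ℝ => x ^ 2).indicator hS
  have hY := hasGaussianLaw_dotProduct xstar
  have hW := hasGaussianLaw_dotProduct w
  have hE1 := integral_indicator_sqAnnulus_dotProduct_le hx (g := fun x => |x|)
    (by fun_prop) abs_nonneg (gaussianPDFReal_mul_abs_le hx) α hε0 hε1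
  have hE2 := integral_indicator_sqAnnulus_dotProduct_le hx (g := fun x => x ^ 2)
    (by fun_prop) sq_nonneg (gaussianPDFReal_mul_sq_le hx) α hε0 hε1
  have hindep : IndepFun (fun a => (sqAnnulus ε α).indicator (fun x => |x|) (a ⬝ᵥ xstar))
      (fun a => |a ⬝ᵥ w|) (gaussianVec n) :=
    (indepFun_dotProduct_gaussianVec horth).comp hSabs measurable_norm
  have hint1 : Integrable (fun a => (sqAnnulus ε α).indicator (fun x => |x|) (a ⬝ᵥ xstar))
      (gaussianVec n) := by
    refine hY.integrable.mono (hSabs.comp_aemeasurable hY.aemeasurable).aestronglyMeasurable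
      (ae_of_all _ fun a => (norm_indicator_le_norm_self _ _).trans ?_)
    simp
  have hint2 : Integrable (fun a => (sqAnnulus ε α).indicator (fun x => x ^ 2) (a ⬝ᵥ xstar))
      (gaussianVec n) :=
    hY.memLp_two.integrable_sq.mono
      (hSsq.comp_aemeasurable hY.aemeasurable).aestronglyMeasurable
      (ae_of_all _ fun a => norm_indicator_le_norm_self _ _)
  have hintW := hW.integrable.abs
  have hint3 : Integrable (fun a => (sqAnnulus ε α).indicator (fun x => |x|) (a ⬝ᵥ xstar)
      * |a ⬝ᵥ w|) (gaussianVec n) := hindep.integrable_mul hint1 hintW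
  calc _ ≤ ∫ a, (|c| * (sqAnnulus ε α).indicator (fun x => x ^ 2) (a ⬝ᵥ xstar)
          + (sqAnnulus ε α).indicator (fun x => |x|) (a ⬝ᵥ xstar) * |a ⬝ᵥ w|)
          ∂(gaussianVec n) := by
        refine integral_mono_of_nonneg (ae_of_all _ fun a => ?_)
          ((hint2.const_mul |c|).add hint3) (ae_of_all _ fun a => ?_)
        · dsimp only [Pi.zero_apply]
          split_ifs <;> positivity
        · dsimp only
          by_cases h : a ⬝ᵥ xstar ∈ sqAnnulus ε α
          · rw [Set.indicator_of_mem h, Set.indicator_of_mem h,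
              if_pos (show _ ∧ _ from h), mul_one, abs_mul]
            have hadd : |a ⬝ᵥ z| ≤ |c| * |a ⬝ᵥ xstar| + |a ⬝ᵥ w| := by
              rw [hz, dotProduct_add, dotProduct_smul, smul_eq_mul, ← abs_mul]
              exact abs_add_le _ _
            nlinarith [mul_le_mul_of_nonneg_left hadd (abs_nonneg (a ⬝ᵥ xstar)),
              sq_abs (a ⬝ᵥ xstar)]
          · rw [Set.indicator_of_notMem h, Set.indicator_of_notMem h,
              if_neg (show ¬(_ ∧ _) from h)]
            simp
    _ = |c| * ∫ a, (sqAnnulus ε α).indicator (fun x => x ^ 2) (a ⬝ᵥ xstar) ∂(gaussianVec n)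
          + (∫ a, (sqAnnulus ε α).indicator (fun x => |x|) (a ⬝ᵥ xstar) ∂(gaussianVec n))
            * ∫ a, |a ⬝ᵥ w| ∂(gaussianVec n) := by
        rw [integral_add (hint2.const_mul |c|) hint3, integral_const_mul,
          hindep.integral_fun_mul_eq_mul_integral hint1.1 hintW.1]
    _ ≤ |c| * (2 / 5 * vnorm xstar * (3 * ε * √α)) + 2 / 5 * (3 * ε * √α) * vnorm z :=
        add_le_add (mul_le_mul_of_nonneg_left hE2 (abs_nonneg c))
          (mul_le_mul hE1 ((integral_abs_dotProduct_gaussianVec_le w).trans hw)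
            (integral_nonneg fun _ => abs_nonneg _) (by positivity))
    _ ≤ 3 * ε * vnorm z * √α := by
        have hpos : 0 ≤ ε * √α := by positivity
        nlinarith [mul_le_mul_of_nonneg_left hc hpos, mul_nonneg hpos hz0]
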